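/- arXiv:1804.02495 — 2 statements merged into one kernel-verified Lean document; each statement's English description precedes it below -/
import Mathlib

section
/- Let n ≥ 1 be odd and let β : ℝⁿ × ℝⁿ → ℝ be the alternating bilinear form β(u, w) = ∑_{1 ≤ j < k ≤ n} (−1)^{k−j−1}·(u_j·w_k − u_k·w_j). Let c : Fin n → Fin n be the cyclic shift c(i) = i + 1 (mod n). Then for all u, w ∈ ℝⁿ one has β(u ∘ c, w ∘ c) = β(u, w); i.e., β is invariant under cyclic relabeling of the coordinates. -/
open Finset

/-- The vertex contribution to Kontsevich's Poisson bivector: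
`β(u, w) = ∑_{1 ≤ j < k ≤ n} (−1)^{k−j−1}·(u_j·w_k − u_k·w_j)`. -/
noncomputable def beta (n : ℕ) (u w : Fin n → ℝ) : ℝ :=
  ∑ j : Fin n, ∑ k : Fin n,
    if j < k then (-1 : ℝ) ^ (k.val - j.val - 1) * (u j * w k - u k * w j) else 0

/-- For `n ≥ 1` odd, the alternating bilinear form `β` is invariant under the
cyclic shift `c(i) = i + 1 (mod n)` of the coordinates: `β(u ∘ c, w ∘ c) = β(u, w)`. -/
theorem stmt3 (n : ℕ) (hn : 1 ≤ n) (hodd : Odd n) (u w : Fin n → ℝ) :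
    beta n (fun i => u ⟨(i.val + 1) % n, Nat.mod_lt _ (by omega)⟩)
           (fun i => w ⟨(i.val + 1) % n, Nat.mod_lt _ (by omega)⟩)
      = beta n u w := by
  obtain ⟨m, rfl⟩ : ∃ m, n = m + 1 := ⟨n - 1, by omega⟩
  have hm : Even m := by
    rcases hodd with ⟨t, ht⟩
    exact ⟨t, by omega⟩
  have h1 : ∀ i : Fin m, (⟨(i.castSucc.val + 1) % (m + 1), Nat.mod_lt _ (by omega)⟩ : Fin (m + 1))
      = i.succ := by
    intro i
    apply Fin.ext
    simp only [Fin.val_castSucc, Fin.val_succ]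
    exact Nat.mod_eq_of_lt (by omega)
  have h2 : (⟨((Fin.last m).val + 1) % (m + 1), Nat.mod_lt _ (by omega)⟩ : Fin (m + 1)) = 0 := by
    apply Fin.ext
    simp
  unfold beta
  have L : ∀ F : Fin (m + 1) → Fin (m + 1) → ℝ, ∑ j, ∑ k, F j k =
      ∑ j : Fin m, (∑ k : Fin m, F j.castSucc k.castSucc + F j.castSucc (Fin.last m)) +
        (∑ k : Fin m, F (Fin.last m) k.castSucc + F (Fin.last m) (Fin.last m)) := by
    intro F
    simp only [Fin.sum_univ_castSucc]
  have R : ∀ F : Fin (m + 1) → Fin (m + 1) → ℝ, ∑ j, ∑ k, F j k =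
      (F 0 0 + ∑ k : Fin m, F 0 k.succ) +
        ∑ j : Fin m, (F j.succ 0 + ∑ k : Fin m, F j.succ k.succ) := by
    intro F
    simp only [Fin.sum_univ_succ]
  refine (L _).trans (Eq.trans ?_ (R _).symm)
  simp only [h1, h2]
  have h3 : ∀ i : Fin m, ¬ (Fin.last m < i.castSucc) := fun i => by
    simp [Fin.lt_def]
  have h4 : ∀ i : Fin m, ¬ (i.succ < 0) := fun i => by simp
  simp only [h3, h4, lt_irrefl, if_false, Finset.sum_const_zero, add_zero, zero_add,
    Finset.sum_add_distrib, Fin.castSucc_lt_castSucc_iff, Fin.succ_lt_succ_iff,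
    Fin.castSucc_lt_last, Fin.succ_pos, if_true, Fin.val_castSucc, Fin.val_succ, Fin.val_last,
    Fin.val_zero, Nat.add_sub_add_right]
  rw [add_comm]
  congr 1
  apply Finset.sum_congr rfl
  intro i _
  have h5 : (-1 : ℝ) ^ (m - i.val - 1) = - (-1) ^ i.val := by
    have hi := i.isLt
    have h6 : (-1 : ℝ) ^ (m - i.val - 1) * (-1) ^ (i.val + 1) = 1 := by
      rw [← pow_add, show m - i.val - 1 + (i.val + 1) = m by omega]
      exact hm.neg_one_pow
    rcases neg_one_pow_eq_or ℝ i.val with h | h <;> rw [pow_succ, h] at h6 <;> rw [h] <;> linarith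
  rw [h5]
  simp only [Nat.sub_zero, Nat.add_sub_cancel]
  ring
end

section
/- Let n ≥ 2 and let η : ℝⁿ × ℝⁿ → ℝ be the alternating bilinear form η(u, w) = ∑_{1 ≤ j < k ≤ n} (u_j·w_k − u_k·w_j). Let c : Fin n → Fin n be the cyclic shift c(i) = i + 1 (mod n). Then for all u, w ∈ ℝⁿ, η(u ∘ c, w ∘ c) = η(u, w) − 2·(u_1·(∑_{j=1}^n w_j) − w_1·(∑_{j=1}^n u_j)). In particular, if ∑_{j=1}^n u_j = 0 and ∑_{j=1}^n w_j = 0, then η(u ∘ c, w ∘ c) = η(u, w). -/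
open Finset

/-- The Kontsevich face 2-form `η(u, w) = ∑_{1 ≤ j < k ≤ n} (u_j·w_k − u_k·w_j)`
in edge-length coordinates. -/
noncomputable def eta (n : ℕ) (u w : Fin n → ℝ) : ℝ :=
  ∑ j : Fin n, ∑ k : Fin n, if j < k then u j * w k - u k * w j else 0

/-- For `n ≥ 2` and the cyclic shift `c(i) = i + 1 (mod n)`, one has
`η(u ∘ c, w ∘ c) = η(u, w) − 2·(u_1·(∑ w_j) − w_1·(∑ u_j))` (the first coordinate is
index `0` here); in particular, if `∑ u_j = 0` and `∑ w_j = 0` then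
`η(u ∘ c, w ∘ c) = η(u, w)`. -/
theorem stmt4 (n : ℕ) (hn : 2 ≤ n) (u w : Fin n → ℝ) :
    (eta n (fun i => u ⟨(i.val + 1) % n, Nat.mod_lt _ (by omega)⟩)
           (fun i => w ⟨(i.val + 1) % n, Nat.mod_lt _ (by omega)⟩)
      = eta n u w
        - 2 * (u ⟨0, by omega⟩ * (∑ j, w j) - w ⟨0, by omega⟩ * (∑ j, u j)))
    ∧ ((∑ j, u j) = 0 → (∑ j, w j) = 0 →
        eta n (fun i => u ⟨(i.val + 1) % n, Nat.mod_lt _ (by omega)⟩)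
              (fun i => w ⟨(i.val + 1) % n, Nat.mod_lt _ (by omega)⟩)
          = eta n u w) := by
  have key : eta n (fun i => u ⟨(i.val + 1) % n, Nat.mod_lt _ (by omega)⟩)
           (fun i => w ⟨(i.val + 1) % n, Nat.mod_lt _ (by omega)⟩)
      = eta n u w
        - 2 * (u ⟨0, by omega⟩ * (∑ j, w j) - w ⟨0, by omega⟩ * (∑ j, u j)) := by
    obtain ⟨m, rfl⟩ : ∃ m, n = m + 1 := ⟨n - 1, by omega⟩
    have h1 : ∀ i : Fin m, (⟨((Fin.castSucc i).val + 1) % (m + 1),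
        Nat.mod_lt _ (by omega)⟩ : Fin (m + 1)) = i.succ := by
      intro i
      ext
      simp [Nat.mod_eq_of_lt]
    have h2 : (⟨((Fin.last m).val + 1) % (m + 1),
        Nat.mod_lt _ (by omega)⟩ : Fin (m + 1)) = 0 := by
      ext
      simp
    have h0 : (⟨0, by omega⟩ : Fin (m + 1)) = 0 := rfl
    have hL : eta (m + 1) (fun i => u ⟨(i.val + 1) % (m + 1), Nat.mod_lt _ (by omega)⟩)
           (fun i => w ⟨(i.val + 1) % (m + 1), Nat.mod_lt _ (by omega)⟩)
        = eta m (fun i => u i.succ) (fun i => w i.succ)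
          + ((∑ i : Fin m, u i.succ) * w 0 - u 0 * ∑ i : Fin m, w i.succ) := by
      unfold eta
      rw [Fin.sum_univ_castSucc]
      simp only [Fin.sum_univ_castSucc (n := m), h1, h2, Fin.castSucc_lt_castSucc_iff,
        Fin.castSucc_lt_last, if_true, lt_irrefl, if_false, not_lt_of_gt (Fin.castSucc_lt_last _),
        Finset.sum_const_zero, Finset.sum_add_distrib, Finset.sum_sub_distrib,
        Finset.sum_mul, Finset.mul_sum, add_zero]
    have hR : eta (m + 1) u w
        = eta m (fun i => u i.succ) (fun i => w i.succ)
          + (u 0 * (∑ i : Fin m, w i.succ) - (∑ i : Fin m, u i.succ) * w 0) := by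
      unfold eta
      rw [Fin.sum_univ_succ]
      simp only [Fin.sum_univ_succ (n := m), Fin.succ_lt_succ_iff,
        Fin.succ_pos, if_true, lt_irrefl, if_false, Fin.not_lt_zero,
        Finset.sum_add_distrib, Finset.sum_sub_distrib,
        Finset.sum_mul, Finset.mul_sum, zero_add]
      ring
    rw [hL, hR, h0, Fin.sum_univ_succ, Fin.sum_univ_succ]
    ring
  refine ⟨key, fun hu hw => ?_⟩
  rw [key, hu, hw]
  ring
end
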